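/- Let ε ∈ ℂ and let K be the pair K¹ = B₃[u] + ε D_x(v₂ + 2u v₁ + v u₁ + u²v), K² = v₃ + 6u₁v₁ − ε(v v₂ − v₁² + v²u₁). Then the pair τ = (τ¹,τ²) with τ¹ = −x u₃ − εx v₃ − εx v u₂ − 3x u u₂ − 2u₂ − 2εx u v₂ − (4/3)ε v₂ − 3x u₁² − 3εx u₁v₁ − 2εx u v u₁ − 3x u²u₁ − (4/3)ε v u₁ − 5u u₁ − εx u²v₁ − (7/3)ε u v₁ − ε u²v − u³ and τ² = −x v₃ + εx v v₂ − v₂ − 6x u₁v₁ + εx v²u₁ − εx v₁² + (1/3)ε v v₁ − 2u v₁ + (1/3)ε u v² satisfies [τ,K] ≠ 0 and [[τ,K],K] = 0; hence τ is a master symmetry of the system u_t = K¹, v_t = K². -/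

import Mathlib

open MvPolynomial

/-- The two-component differential ring `𝒜₂ = ℂ[x, u₀, u₁, …, v₀, v₁, …]`:
variable `none` is `x`, `some (false, k)` is `u_k`, `some (true, k)` is `v_k`. -/
abbrev A2 : Type := MvPolynomial (Option (Bool × ℕ)) ℂ

/-- The variable `x`. -/
noncomputable def Xx : A2 := X none

/-- The variable `u_k`. -/
noncomputable def U (k : ℕ) : A2 := X (some (false, k))

/-- The variable `v_k`. -/
noncomputable def V (k : ℕ) : A2 := X (some (true, k))

/-- The total derivative `D_x = ∂/∂x + Σ_{k≥0} (u_{k+1} ∂/∂u_k + v_{k+1} ∂/∂v_k)`. -/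
noncomputable def Dx (P : A2) : A2 :=
  pderiv (none : Option (Bool × ℕ)) P +
    ∑ᶠ k : ℕ, (U (k + 1) * pderiv (some (false, k)) P +
      V (k + 1) * pderiv (some (true, k)) P)

/-- `frU P Q = P_{u*}(Q) = Σ_k (∂P/∂u_k) D_x^k(Q)`. -/
noncomputable def frU (P Q : A2) : A2 :=
  ∑ᶠ k : ℕ, pderiv (some (false, k)) P * Dx^[k] Q

/-- `frV P Q = P_{v*}(Q) = Σ_k (∂P/∂v_k) D_x^k(Q)`. -/
noncomputable def frV (P Q : A2) : A2 :=
  ∑ᶠ k : ℕ, pderiv (some (true, k)) P * Dx^[k] Q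

/-- The Lie bracket of two pairs (evolutionary vector fields). -/
noncomputable def lieBr2 (P J : A2 × A2) : A2 × A2 :=
  (frU J.1 P.1 + frV J.1 P.2 - frU P.1 J.1 - frV P.1 J.2,
   frU J.2 P.1 + frV J.2 P.2 - frU P.2 J.1 - frV P.2 J.2)

/-- The third-order Burgers flow `B₃[u] = u₃ + 3u u₂ + 3u² u₁ + 3u₁²`. -/
noncomputable def B3 : A2 := U 3 + 3 * U 0 * U 2 + 3 * U 0 ^ 2 * U 1 + 3 * U 1 ^ 2

/-- The total derivative `Dx` as a `ℂ`-linear derivation of `A2`. -/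
noncomputable def totalDerivation : Derivation ℂ A2 A2 :=
  mkDerivation ℂ fun i => match i with
    | none => 1
    | some (false, k) => U (k + 1)
    | some (true, k) => V (k + 1)

/-- The evolutionary derivation with characteristic `Q`, sending `u_k` to `D_x^k Q¹`
and `v_k` to `D_x^k Q²`. -/
noncomputable def evolutionary (Q : A2 × A2) : Derivation ℂ A2 A2 :=
  mkDerivation ℂ fun i => match i with
    | none => 0
    | some (false, k) => Dx^[k] Q.1
    | some (true, k) => Dx^[k] Q.2

lemma finite_support_pderiv_mul (b : Bool) (P : A2) (f : ℕ → A2) :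
    (Function.support fun k => pderiv (some (b, k)) P * f k).Finite := by
  refine (P.vars.finite_toSet.preimage (f := fun k : ℕ => some (b, k)) ?_).subset ?_
  · intro i _ j _ h
    simpa using h
  · intro k hk
    by_contra h
    exact hk (by simp [pderiv_eq_zero_of_notMem_vars (i := some (b, k)) (f := P) h])

/-- The operator `P ↦ Σ_k (∂P/∂w_k) f_k` as a derivation, `w` being `u` or `v`. -/
noncomputable def jetDerivation (b : Bool) (f : ℕ → A2) : Derivation ℂ A2 A2 :=
  Derivation.mk'
    { toFun := fun P => ∑ᶠ k : ℕ, pderiv (some (b, k)) P * f k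
      map_add' := fun P Q => by
        rw [← finsum_add_distrib (finite_support_pderiv_mul b P f)
          (finite_support_pderiv_mul b Q f)]
        simp only [map_add, add_mul]
      map_smul' := fun c P => by
        simp only [RingHom.id_apply]
        rw [smul_finsum' c (finite_support_pderiv_mul b P f)]
        simp }
    fun P Q => by
      have hP := finite_support_pderiv_mul b P f
      have hQ := finite_support_pderiv_mul b Q f
      have h : ∀ k, pderiv (some (b, k)) (P * Q) * f k =
          P * (pderiv (some (b, k)) Q * f k) + Q * (pderiv (some (b, k)) P * f k) := fun k => by
        rw [Derivation.leibniz]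
        simp only [smul_eq_mul]
        ring
      simp only [LinearMap.coe_mk, AddHom.coe_mk, smul_eq_mul, h]
      rw [mul_finsum, mul_finsum, finsum_add_distrib]
      · exact hQ.subset fun k hk h0 => hk (by simp_all)
      · exact hP.subset fun k hk h0 => hk (by simp_all)

lemma jetDerivation_apply (b : Bool) (f : ℕ → A2) (P : A2) :
    jetDerivation b f P = ∑ᶠ k : ℕ, pderiv (some (b, k)) P * f k := rfl

lemma jetDerivation_X_self (b : Bool) (f : ℕ → A2) (k : ℕ) :
    jetDerivation b f (X (some (b, k))) = f k := by
  rw [jetDerivation_apply, finsum_eq_single _ k]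
  · simp
  · intro j hj
    rw [pderiv_X_of_ne (by simpa using hj.symm), zero_mul]

lemma jetDerivation_X_of_ne (b : Bool) (f : ℕ → A2) (i : Option (Bool × ℕ))
    (hi : ∀ k, i ≠ some (b, k)) : jetDerivation b f (X i) = 0 := by
  rw [jetDerivation_apply]
  simp [pderiv_X_of_ne (hi _)]

lemma frU_add_frV (P : A2) (Q : A2 × A2) : frU P Q.1 + frV P Q.2 = evolutionary Q P := by
  have h : jetDerivation false (fun k => Dx^[k] Q.1) + jetDerivation true (fun k => Dx^[k] Q.2) =
      evolutionary Q := by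
    refine derivation_ext fun i => ?_
    rcases i with _ | ⟨_ | _, k⟩ <;>
      simp [evolutionary, mkDerivation_X, jetDerivation_X_self, jetDerivation_X_of_ne]
  rw [← h]
  rfl

lemma Dx_eq_totalDerivation : Dx = totalDerivation := by
  have h : pderiv (none : Option (Bool × ℕ)) + (jetDerivation false (fun k => U (k + 1)) +
      jetDerivation true (fun k => V (k + 1))) = totalDerivation := by
    refine derivation_ext fun i => ?_
    rcases i with _ | ⟨_ | _, k⟩ <;>
      simp [totalDerivation, mkDerivation_X, jetDerivation_X_self, jetDerivation_X_of_ne, pderiv_X]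
  funext P
  rw [← h, Derivation.add_apply, Derivation.add_apply, jetDerivation_apply, jetDerivation_apply,
    ← finsum_add_distrib (finite_support_pderiv_mul _ _ _) (finite_support_pderiv_mul _ _ _)]
  simp only [Dx, mul_comm]

lemma lieBr2_eq (P J : A2 × A2) :
    lieBr2 P J = (evolutionary P J.1 - evolutionary J P.1,
      evolutionary P J.2 - evolutionary J P.2) := by
  simp only [lieBr2, ← frU_add_frV, sub_sub]

section Dx

lemma Dx_add (P Q : A2) : Dx (P + Q) = Dx P + Dx Q := by
  simp [Dx_eq_totalDerivation]

lemma Dx_sub (P Q : A2) : Dx (P - Q) = Dx P - Dx Q := by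
  simp [Dx_eq_totalDerivation]

lemma Dx_neg (P : A2) : Dx (-P) = -Dx P := by
  simp [Dx_eq_totalDerivation]

lemma Dx_mul (P Q : A2) : Dx (P * Q) = P * Dx Q + Q * Dx P := by
  simp [Dx_eq_totalDerivation]

lemma Dx_pow (P : A2) (n : ℕ) : Dx (P ^ n) = n * P ^ (n - 1) * Dx P := by
  simp [Dx_eq_totalDerivation, mul_assoc]

lemma Dx_C (c : ℂ) : Dx (C c) = 0 := by
  rw [Dx_eq_totalDerivation]
  exact totalDerivation.map_algebraMap c

lemma Dx_ofNat (n : ℕ) [n.AtLeastTwo] : Dx (ofNat(n) : A2) = 0 := by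
  rw [Dx_eq_totalDerivation]
  exact totalDerivation.map_natCast n

lemma Dx_Xx : Dx Xx = 1 := by
  simp [Dx_eq_totalDerivation, totalDerivation, Xx, mkDerivation_X]

lemma Dx_U (k : ℕ) : Dx (U k) = U (k + 1) := by
  rw [Dx_eq_totalDerivation, U, totalDerivation, mkDerivation_X]

lemma Dx_V (k : ℕ) : Dx (V k) = V (k + 1) := by
  rw [Dx_eq_totalDerivation, V, totalDerivation, mkDerivation_X]

lemma iterate_Dx_add (n : ℕ) (P Q : A2) : Dx^[n] (P + Q) = Dx^[n] P + Dx^[n] Q :=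
  Function.Semiconj₂.iterate Dx_add n P Q

lemma iterate_Dx_sub (n : ℕ) (P Q : A2) : Dx^[n] (P - Q) = Dx^[n] P - Dx^[n] Q :=
  Function.Semiconj₂.iterate Dx_sub n P Q

lemma iterate_Dx_neg (n : ℕ) (P : A2) : Dx^[n] (-P) = -Dx^[n] P :=
  (Function.Commute.iterate_left (f := Dx) (g := fun P => -P) Dx_neg n) P

lemma iterate_Dx_C_mul (n : ℕ) (c : ℂ) (P : A2) : Dx^[n] (C c * P) = C c * Dx^[n] P :=
  (Function.Commute.iterate_left (f := Dx) (g := fun P => C c * P)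
    (fun P => by simp [Dx_mul, Dx_C]) n) P

lemma iterate_Dx_ofNat_mul (n m : ℕ) [m.AtLeastTwo] (P : A2) :
    Dx^[n] (ofNat(m) * P) = ofNat(m) * Dx^[n] P :=
  (Function.Commute.iterate_left (f := Dx) (g := fun P => ofNat(m) * P)
    (fun P => by simp [Dx_mul, Dx_ofNat]) n) P

lemma iterate_Dx_U (n k : ℕ) : Dx^[n] (U k) = U (k + n) := by
  induction n with
  | zero => rfl
  | succ n ih => rw [Function.iterate_succ_apply', ih, Dx_U, add_assoc]

lemma iterate_Dx_V (n k : ℕ) : Dx^[n] (V k) = V (k + n) := by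
  induction n with
  | zero => rfl
  | succ n ih => rw [Function.iterate_succ_apply', ih, Dx_V, add_assoc]

lemma iterate_one_Dx_mul (P Q : A2) : Dx^[1] (P * Q) = P * Dx^[1] Q + Dx^[1] P * Q := by
  simp only [Function.iterate_one, Dx_mul]
  ring

lemma iterate_two_Dx_mul (P Q : A2) :
    Dx^[2] (P * Q) = P * Dx^[2] Q + 2 * (Dx^[1] P * Dx^[1] Q) + Dx^[2] P * Q := by
  rw [Function.iterate_succ_apply', iterate_one_Dx_mul]
  simp only [Function.iterate_succ_apply', Function.iterate_zero_apply, Dx_add, Dx_mul]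
  ring

lemma iterate_three_Dx_mul (P Q : A2) :
    Dx^[3] (P * Q) = P * Dx^[3] Q + 3 * (Dx^[1] P * Dx^[2] Q) + 3 * (Dx^[2] P * Dx^[1] Q) +
      Dx^[3] P * Q := by
  rw [Function.iterate_succ_apply', iterate_two_Dx_mul]
  simp only [Function.iterate_succ_apply', Function.iterate_zero_apply, Dx_add, Dx_mul, Dx_ofNat]
  ring

lemma iterate_four_Dx_mul (P Q : A2) :
    Dx^[4] (P * Q) = P * Dx^[4] Q + 4 * (Dx^[1] P * Dx^[3] Q) + 6 * (Dx^[2] P * Dx^[2] Q) +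
      4 * (Dx^[3] P * Dx^[1] Q) + Dx^[4] P * Q := by
  rw [Function.iterate_succ_apply', iterate_three_Dx_mul]
  simp only [Function.iterate_succ_apply', Function.iterate_zero_apply, Dx_add, Dx_mul, Dx_ofNat]
  ring

lemma iterate_five_Dx_mul (P Q : A2) :
    Dx^[5] (P * Q) = P * Dx^[5] Q + 5 * (Dx^[1] P * Dx^[4] Q) + 10 * (Dx^[2] P * Dx^[3] Q) +
      10 * (Dx^[3] P * Dx^[2] Q) + 5 * (Dx^[4] P * Dx^[1] Q) + Dx^[5] P * Q := by
  rw [Function.iterate_succ_apply', iterate_four_Dx_mul]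
  simp only [Function.iterate_succ_apply', Function.iterate_zero_apply, Dx_add, Dx_mul, Dx_ofNat]
  ring

end Dx

section evolutionary

variable (Q : A2 × A2)

lemma evolutionary_C (c : ℂ) : evolutionary Q (C c) = 0 :=
  (evolutionary Q).map_algebraMap c

lemma evolutionary_ofNat (n : ℕ) [n.AtLeastTwo] : evolutionary Q (ofNat(n) : A2) = 0 :=
  (evolutionary Q).map_natCast n

lemma evolutionary_Xx : evolutionary Q Xx = 0 := by
  rw [Xx, evolutionary, mkDerivation_X]

lemma evolutionary_U (k : ℕ) : evolutionary Q (U k) = Dx^[k] Q.1 := by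
  rw [U, evolutionary, mkDerivation_X]

lemma evolutionary_V (k : ℕ) : evolutionary Q (V k) = Dx^[k] Q.2 := by
  rw [V, evolutionary, mkDerivation_X]

end evolutionary

/-- The right-hand side of the system, with `ε = 3δ`. -/
noncomputable def systemField (δ : ℂ) : A2 × A2 :=
  (U 3 + 3 * U 0 * U 2 + 3 * U 0 ^ 2 * U 1 + 3 * U 1 ^ 2 +
     3 * C δ * (V 3 + 2 * U 0 * V 2 + 3 * U 1 * V 1 + V 0 * U 2 + U 0 ^ 2 * V 1 +
       2 * U 0 * U 1 * V 0),
   V 3 + 6 * U 1 * V 1 - 3 * C δ * (V 0 * V 2 - V 1 ^ 2 + V 0 ^ 2 * U 1))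

/-- The master symmetry, with `ε = 3δ`. -/
noncomputable def masterField (δ : ℂ) : A2 × A2 :=
  (-(Xx * (systemField δ).1) - 2 * U 2 - 5 * U 0 * U 1 - U 0 ^ 3 -
     C δ * (4 * V 2 + 4 * V 0 * U 1 + 7 * U 0 * V 1 + 3 * U 0 ^ 2 * V 0),
   -(Xx * (systemField δ).2) - V 2 - 2 * U 0 * V 1 + C δ * (V 0 * V 1 + U 0 * V 0 ^ 2))

/-- The fifth-order symmetry `[τ, K]`, with `ε = 3δ`. -/
noncomputable def fifthOrderSymmetry (δ : ℂ) : A2 × A2 :=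
  (-(45 * U 1 ^ 3) - 30 * U 2 ^ 2 - 3 * U 5 - 15 * U 0 * U 4 - 90 * U 0 ^ 2 * U 1 ^ 2 -
   30 * U 0 ^ 2 * U 3 - 30 * U 0 ^ 3 * U 2 - 15 * U 0 ^ 4 * U 1 - 45 * U 1 * U 3 -
   150 * U 0 * U 1 * U 2 - 15 * C δ * V 5 - 45 * C δ * U 0 * V 4 - 60 * C δ * U 0 ^ 2 * V 3 -
   45 * C δ * U 0 ^ 3 * V 2 - 15 * C δ * U 0 ^ 4 * V 1 - 135 * C δ * U 1 * V 3 -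
   210 * C δ * U 1 ^ 2 * V 1 - 165 * C δ * U 2 * V 2 - 90 * C δ * U 3 * V 1 -
   15 * C δ * U 4 * V 0 - 285 * C δ * U 0 * U 1 * V 2 - 180 * C δ * U 0 * U 1 ^ 2 * V 0 -
   225 * C δ * U 0 * U 2 * V 1 - 60 * C δ * U 0 * U 3 * V 0 - 225 * C δ * U 0 ^ 2 * U 1 * V 1 -
   90 * C δ * U 0 ^ 2 * U 2 * V 0 - 60 * C δ * U 0 ^ 3 * U 1 * V 0 - 150 * C δ * U 1 * U 2 * V 0 -
   30 * C δ ^ 2 * V 2 ^ 2 - 60 * C δ ^ 2 * U 0 ^ 2 * V 1 ^ 2 - 75 * C δ ^ 2 * U 1 * V 1 ^ 2 -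
   30 * C δ ^ 2 * U 1 ^ 2 * V 0 ^ 2 - 30 * C δ ^ 2 * V 1 * V 3 -
   30 * C δ ^ 2 * U 0 * U 2 * V 0 ^ 2 - 30 * C δ ^ 2 * U 0 * V 0 * V 3 -
   120 * C δ ^ 2 * U 0 * V 1 * V 2 - 45 * C δ ^ 2 * U 0 ^ 2 * U 1 * V 0 ^ 2 -
   60 * C δ ^ 2 * U 0 ^ 2 * V 0 * V 2 - 30 * C δ ^ 2 * U 0 ^ 3 * V 0 * V 1 -
   60 * C δ ^ 2 * U 1 * V 0 * V 2 - 30 * C δ ^ 2 * U 2 * V 0 * V 1 -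
   180 * C δ ^ 2 * U 0 * U 1 * V 0 * V 1,
   -(3 * V 5) - 30 * U 1 * V 3 - 90 * U 1 ^ 2 * V 1 - 30 * U 2 * V 2 - 30 * U 3 * V 1 -
   30 * U 0 * U 2 * V 1 - 30 * U 0 ^ 2 * U 1 * V 1 - 30 * C δ * U 0 ^ 2 * V 1 ^ 2 -
   150 * C δ * U 1 * V 1 ^ 2 + 45 * C δ * U 1 ^ 2 * V 0 ^ 2 + 15 * C δ * U 3 * V 0 ^ 2 +
   15 * C δ * V 0 * V 4 - 45 * C δ * V 1 * V 3 + 15 * C δ * U 0 * U 2 * V 0 ^ 2 -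
   60 * C δ * U 0 * V 1 * V 2 + 15 * C δ * U 0 ^ 2 * U 1 * V 0 ^ 2 + 90 * C δ * U 1 * V 0 * V 2 +
   30 * C δ * U 2 * V 0 * V 1 - 60 * C δ * U 0 * U 1 * V 0 * V 1 - 15 * C δ ^ 2 * V 1 ^ 3 +
   30 * C δ ^ 2 * U 0 * U 1 * V 0 ^ 3 + 30 * C δ ^ 2 * U 0 * V 0 ^ 2 * V 2 +
   15 * C δ ^ 2 * U 0 ^ 2 * V 0 ^ 2 * V 1 + 30 * C δ ^ 2 * U 1 * V 0 ^ 2 * V 1 +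
   30 * C δ ^ 2 * V 0 * V 1 * V 2)

set_option maxRecDepth 10000 in
lemma lieBr2_masterField_systemField (δ : ℂ) :
    lieBr2 (masterField δ) (systemField δ) = fifthOrderSymmetry δ := by
  rw [lieBr2_eq]
  refine Prod.ext ?_ ?_ <;>
  · simp only [masterField, systemField, fifthOrderSymmetry, map_add, map_sub, map_neg,
      Derivation.leibniz, Derivation.leibniz_pow, smul_eq_mul, nsmul_eq_mul, evolutionary_C,
      evolutionary_ofNat, evolutionary_Xx, evolutionary_U, evolutionary_V, Function.iterate_succ,
      Function.iterate_zero, Function.comp_apply, id_eq, Dx_add, Dx_sub, Dx_neg, Dx_mul, Dx_pow,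
      Dx_C, Dx_ofNat, Dx_Xx, Dx_U, Dx_V, Nat.reduceAdd, Nat.reduceSub, pow_one,
      mul_zero, add_zero, zero_add, mul_one, Nat.cast_ofNat]
    ring

set_option maxRecDepth 10000 in
lemma evolutionary_fifthOrderSymmetry_systemField_fst (δ : ℂ) :
    evolutionary (fifthOrderSymmetry δ) (systemField δ).1 =
      evolutionary (systemField δ) (fifthOrderSymmetry δ).1 := by
  conv_lhs => rw [systemField]
  conv_rhs => rw [fifthOrderSymmetry]
  simp only [map_add, map_sub, map_neg, Derivation.leibniz, Derivation.leibniz_pow, smul_eq_mul,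
    nsmul_eq_mul, evolutionary_C, evolutionary_ofNat, evolutionary_U, evolutionary_V, mul_zero,
    add_zero, Nat.cast_ofNat, Nat.reduceSub, pow_one]
  simp only [systemField, fifthOrderSymmetry, pow_succ, pow_zero, one_mul, mul_assoc,
    iterate_Dx_add, iterate_Dx_sub, iterate_Dx_neg, iterate_Dx_C_mul, iterate_Dx_ofNat_mul,
    iterate_one_Dx_mul, iterate_two_Dx_mul, iterate_three_Dx_mul, iterate_four_Dx_mul,
    iterate_five_Dx_mul, iterate_Dx_U, iterate_Dx_V, Function.iterate_zero, id_eq, Nat.reduceAdd]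
  ring

set_option maxRecDepth 10000 in
lemma evolutionary_fifthOrderSymmetry_systemField_snd (δ : ℂ) :
    evolutionary (fifthOrderSymmetry δ) (systemField δ).2 =
      evolutionary (systemField δ) (fifthOrderSymmetry δ).2 := by
  conv_lhs => rw [systemField]
  conv_rhs => rw [fifthOrderSymmetry]
  simp only [map_add, map_sub, map_neg, Derivation.leibniz, Derivation.leibniz_pow, smul_eq_mul,
    nsmul_eq_mul, evolutionary_C, evolutionary_ofNat, evolutionary_U, evolutionary_V, mul_zero,
    add_zero, Nat.cast_ofNat, Nat.reduceSub, pow_one]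
  simp only [systemField, fifthOrderSymmetry, pow_succ, pow_zero, one_mul, mul_assoc,
    iterate_Dx_add, iterate_Dx_sub, iterate_Dx_neg, iterate_Dx_C_mul, iterate_Dx_ofNat_mul,
    iterate_one_Dx_mul, iterate_two_Dx_mul, iterate_three_Dx_mul, iterate_four_Dx_mul,
    iterate_five_Dx_mul, iterate_Dx_U, iterate_Dx_V, Function.iterate_zero, id_eq, Nat.reduceAdd]
  ring

lemma lieBr2_fifthOrderSymmetry_systemField (δ : ℂ) :
    lieBr2 (fifthOrderSymmetry δ) (systemField δ) = 0 := by
  rw [lieBr2_eq, evolutionary_fifthOrderSymmetry_systemField_fst,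
    evolutionary_fifthOrderSymmetry_systemField_snd, sub_self, sub_self]
  rfl

lemma fifthOrderSymmetry_ne_zero (δ : ℂ) : fifthOrderSymmetry δ ≠ 0 := by
  intro h
  have h5 := congrArg (fun P : A2 × A2 => eval (Pi.single (some (false, 5)) (1 : ℂ)) P.1) h
  simp [fifthOrderSymmetry, U, V] at h5

/-- The stated pair `τ` is a master symmetry of System (13):
`[τ,K] ≠ 0` and `[[τ,K],K] = 0`. -/
theorem system13_master_symmetry (ε : ℂ) :
    let K : A2 × A2 :=
      (B3 + C ε * Dx (V 2 + 2 * U 0 * V 1 + V 0 * U 1 + U 0 ^ 2 * V 0),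
       V 3 + 6 * U 1 * V 1 - C ε * (V 0 * V 2 - V 1 ^ 2 + V 0 ^ 2 * U 1))
    let τ : A2 × A2 :=
      (-(Xx * U 3) - C ε * Xx * V 3 - C ε * Xx * V 0 * U 2 - 3 * Xx * U 0 * U 2 -
         2 * U 2 - 2 * C ε * Xx * U 0 * V 2 - C (4 / 3 * ε) * V 2 - 3 * Xx * U 1 ^ 2 -
         3 * C ε * Xx * U 1 * V 1 - 2 * C ε * Xx * U 0 * V 0 * U 1 -
         3 * Xx * U 0 ^ 2 * U 1 - C (4 / 3 * ε) * V 0 * U 1 - 5 * U 0 * U 1 -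
         C ε * Xx * U 0 ^ 2 * V 1 - C (7 / 3 * ε) * U 0 * V 1 - C ε * U 0 ^ 2 * V 0 -
         U 0 ^ 3,
       -(Xx * V 3) + C ε * Xx * V 0 * V 2 - V 2 - 6 * Xx * U 1 * V 1 +
         C ε * Xx * V 0 ^ 2 * U 1 - C ε * Xx * V 1 ^ 2 + C (1 / 3 * ε) * V 0 * V 1 -
         2 * U 0 * V 1 + C (1 / 3 * ε) * U 0 * V 0 ^ 2)
    lieBr2 τ K ≠ 0 ∧ lieBr2 (lieBr2 τ K) K = 0 := by
  intro K τ
  have h3 : (C ε : A2) = 3 * C (ε / 3) := by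
    rw [← map_ofNat C, ← map_mul, show 3 * (ε / 3) = ε by ring]
  have h4 : (C (4 / 3 * ε) : A2) = 4 * C (ε / 3) := by
    rw [show 4 / 3 * ε = 4 * (ε / 3) by ring, map_mul, map_ofNat]
  have h7 : (C (7 / 3 * ε) : A2) = 7 * C (ε / 3) := by
    rw [show 7 / 3 * ε = 7 * (ε / 3) by ring, map_mul, map_ofNat]
  have h1 : (C (1 / 3 * ε) : A2) = C (ε / 3) := by
    rw [show 1 / 3 * ε = ε / 3 by ring]
  have hK : K = systemField (ε / 3) := by
    refine Prod.ext ?_ ?_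
    · simp only [K, systemField, B3, h3, Dx_add, Dx_mul, Dx_pow, Dx_ofNat, Dx_U, Dx_V]
      push_cast
      ring
    · simp only [K, systemField, h3]
  have hτ : τ = masterField (ε / 3) := by
    refine Prod.ext ?_ ?_ <;>
    · simp only [τ, masterField, systemField, h1, h3, h4, h7]
      ring
  rw [hK, hτ, lieBr2_masterField_systemField]
  exact ⟨fifthOrderSymmetry_ne_zero _, lieBr2_fifthOrderSymmetry_systemField _⟩
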